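/- arXiv:2507.22634 — 6 statements merged into one kernel-verified Lean document; each statement's English description precedes it below -/
import Mathlib

section
/- For every x : Fin N → ℝ, the Chebyshev approximation error of the max-plus equation A ⊗ x = b is bounded below by half the residual: max over i of |max over j of (A i j + x j) − b i| ≥ Δ(A, b) / 2. -/
open Finset

/-- Finite maximum over `Fin n` (nonempty since `NeZero n`). -/
noncomputable def fmax {n : ℕ} [NeZero n] (f : Fin n → ℝ) : ℝ :=
  Finset.univ.sup' Finset.univ_nonempty f

/-- Finite minimum over `Fin n`. -/
noncomputable def fmin {n : ℕ} [NeZero n] (f : Fin n → ℝ) : ℝ :=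
  Finset.univ.inf' Finset.univ_nonempty f

/-- Max-plus matrix-vector product: `(A ⊗ x) i = max_j (A i j + x j)`. -/
noncomputable def mp {M N : ℕ} [NeZero N] (A : Fin M → Fin N → ℝ) (x : Fin N → ℝ) :
    Fin M → ℝ :=
  fun i => fmax (fun j => A i j + x j)

/-- Tropical (Chebyshev) distance. -/
noncomputable def dd {M : ℕ} [NeZero M] (u v : Fin M → ℝ) : ℝ :=
  fmax (fun i => |u i - v i|)

/-- Residual `Δ(A, b)`. -/
noncomputable def resid {M N : ℕ} [NeZero M] [NeZero N]
    (A : Fin M → Fin N → ℝ) (b : Fin M → ℝ) : ℝ :=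
  fmax (fun i => b i - fmax (fun j => A i j + fmin (fun k => b k - A k j)))

lemma le_fmax {n : ℕ} [NeZero n] (f : Fin n → ℝ) (i : Fin n) : f i ≤ fmax f :=
  Finset.le_sup' f (Finset.mem_univ i)

lemma fmax_le {n : ℕ} [NeZero n] {f : Fin n → ℝ} {a : ℝ} (h : ∀ i, f i ≤ a) : fmax f ≤ a :=
  Finset.sup'_le _ f fun i _ => h i

lemma le_fmin {n : ℕ} [NeZero n] {f : Fin n → ℝ} {a : ℝ} (h : ∀ i, a ≤ f i) : a ≤ fmin f :=
  Finset.le_inf' _ f fun i _ => h i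

lemma abs_sub_le_dd {M : ℕ} [NeZero M] (u v : Fin M → ℝ) (i : Fin M) :
    |u i - v i| ≤ dd u v :=
  le_fmax (fun i => |u i - v i|) i

lemma add_le_mp {M N : ℕ} [NeZero N] (A : Fin M → Fin N → ℝ) (x : Fin N → ℝ)
    (i : Fin M) (j : Fin N) : A i j + x j ≤ mp A x i :=
  le_fmax (fun j => A i j + x j) j

/-- for every `x`, the Chebyshev error of `A ⊗ x = b` is at least `Δ(A,b)/2`. -/
theorem maxplus_error_lower_bound (M N : ℕ) [NeZero M] [NeZero N]
    (A : Fin M → Fin N → ℝ) (b : Fin M → ℝ) :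
    ∀ x : Fin N → ℝ, dd (mp A x) b ≥ resid A b / 2 := by
  intro x
  have hx : ∀ j, x j - dd (mp A x) b ≤ fmin (fun k => b k - A k j) := fun j =>
    le_fmin fun k => by
      have h₁ := add_le_mp A x k j
      have h₂ := (abs_le.1 (abs_sub_le_dd (mp A x) b k)).2
      linarith
  have hres : resid A b ≤ 2 * dd (mp A x) b := fmax_le fun i => by
    have h₁ : mp A x i ≤
        fmax (fun j => A i j + fmin (fun k => b k - A k j)) + dd (mp A x) b :=
      fmax_le fun j => by
        have h₂ := le_fmax (fun j => A i j + fmin (fun k => b k - A k j)) j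
        have h₃ := hx j
        linarith
    have h₄ := (abs_le.1 (abs_sub_le_dd (mp A x) b i)).1
    linarith
  linarith
end

section
/- If Δ(A, b) = 0, then the principal solution solves the equation exactly: for every i, max over j of (A i j + x̄(A, b) j) = b i. -/
open Finset

/-- Principal solution `x̄(A, b) j = min_i (b i − A i j)`. -/
noncomputable def xbar {M N : ℕ} [NeZero M]
    (A : Fin M → Fin N → ℝ) (b : Fin M → ℝ) : Fin N → ℝ :=
  fun j => fmin (fun i => b i - A i j)

/-- The product of a matrix with its principal solution never exceeds the right-hand side. -/
theorem fmax_add_xbar_le {M N : ℕ} [NeZero M] [NeZero N]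
    (A : Fin M → Fin N → ℝ) (b : Fin M → ℝ) (i : Fin M) :
    fmax (fun j => A i j + xbar A b j) ≤ b i := by
  refine Finset.sup'_le _ _ fun j _ => ?_
  have hj : xbar A b j ≤ b i - A i j :=
    Finset.inf'_le (fun k => b k - A k j) (Finset.mem_univ i)
  linarith

/-- The residual bounds every coordinate of the defect of the principal solution. -/
theorem sub_fmax_add_xbar_le_resid {M N : ℕ} [NeZero M] [NeZero N]
    (A : Fin M → Fin N → ℝ) (b : Fin M → ℝ) (i : Fin M) :
    b i - fmax (fun j => A i j + xbar A b j) ≤ resid A b :=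
  Finset.le_sup' (fun i => b i - fmax (fun j => A i j + xbar A b j)) (Finset.mem_univ i)

/-- if `Δ(A, b) = 0` then the principal solution solves `A ⊗ x = b` exactly. -/
theorem xbar_exact_of_resid_eq_zero (M N : ℕ) [NeZero M] [NeZero N]
    (A : Fin M → Fin N → ℝ) (b : Fin M → ℝ) (h : resid A b = 0) :
    ∀ i, fmax (fun j => A i j + xbar A b j) = b i := by
  intro i
  refine le_antisymm (fmax_add_xbar_le A b i) ?_
  have hi := sub_fmax_add_xbar_le_resid A b i
  linarith
end

section
/- The max-plus equation A ⊗ x = b has an exact solution if and only if Δ(A, b) = 0; that is, there exists x : Fin N → ℝ with max over j of (A i j + x j) = b i for all i, if and only if Δ(A, b) = 0. -/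
open Finset

lemma fmax_le_iff {n : ℕ} [NeZero n] {f : Fin n → ℝ} {a : ℝ} :
    fmax f ≤ a ↔ ∀ i, f i ≤ a := by
  simp [fmax]

lemma le_fmin_iff {n : ℕ} [NeZero n] {f : Fin n → ℝ} {a : ℝ} :
    a ≤ fmin f ↔ ∀ i, a ≤ f i := by
  simp [fmin]

lemma fmin_le {n : ℕ} [NeZero n] (f : Fin n → ℝ) (i : Fin n) : fmin f ≤ f i :=
  Finset.inf'_le f (Finset.mem_univ i)

/-- The principal solution is a subsolution of `A ⊗ x = b`. -/
lemma mp_xbar_le {M N : ℕ} [NeZero M] [NeZero N] (A : Fin M → Fin N → ℝ) (b : Fin M → ℝ)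
    (i : Fin M) : mp A (xbar A b) i ≤ b i :=
  fmax_le_iff.2 fun j => by
    have := fmin_le (fun k => b k - A k j) i
    simp only [xbar]
    linarith

/-- The principal solution dominates every subsolution of `A ⊗ x = b`. -/
lemma le_xbar {M N : ℕ} [NeZero M] [NeZero N] {A : Fin M → Fin N → ℝ} {b : Fin M → ℝ}
    {x : Fin N → ℝ} (h : ∀ i, mp A x i ≤ b i) (j : Fin N) : x j ≤ xbar A b j :=
  le_fmin_iff.2 fun i => by
    have := fmax_le_iff.1 (h i) j
    linarith

lemma mp_mono {M N : ℕ} [NeZero N] (A : Fin M → Fin N → ℝ) {x y : Fin N → ℝ}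
    (h : ∀ j, x j ≤ y j) (i : Fin M) : mp A x i ≤ mp A y i :=
  fmax_le_iff.2 fun j =>
    (add_le_add_right (h j) (A i j)).trans (le_fmax (fun j => A i j + y j) j)

lemma resid_nonneg {M N : ℕ} [NeZero M] [NeZero N] (A : Fin M → Fin N → ℝ) (b : Fin M → ℝ) :
    0 ≤ resid A b :=
  (sub_nonneg.2 (mp_xbar_le A b 0)).trans (le_fmax (fun i => b i - mp A (xbar A b) i) 0)

/-- `A ⊗ x = b` has an exact solution iff `Δ(A, b) = 0`. -/
theorem maxplus_solvable_iff_resid_eq_zero (M N : ℕ) [NeZero M] [NeZero N]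
    (A : Fin M → Fin N → ℝ) (b : Fin M → ℝ) :
    (∃ x : Fin N → ℝ, ∀ i, fmax (fun j => A i j + x j) = b i) ↔ resid A b = 0 := by
  constructor
  · rintro ⟨x, hx⟩
    refine le_antisymm (fmax_le_iff.2 fun i => sub_nonpos.2 ?_) (resid_nonneg A b)
    exact (hx i).ge.trans (mp_mono A (le_xbar fun k => (hx k).le) i)
  · intro h
    exact ⟨xbar A b, fun i => le_antisymm (mp_xbar_le A b i)
      (sub_nonpos.1 (fmax_le_iff.1 h.le i))⟩
end

section
/- Every minimizer of the max-plus polynomial lies in the interval [L, U]: if t ∈ ℝ satisfies max over j of (θ j + p j · t) = μ, then L ≤ t and t ≤ U. -/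
open Finset

/-- every minimizer of the max-plus polynomial lies in `[L, U]`. -/
theorem tropical_poly_minimizers_in_interval (N : ℕ) [NeZero N] (p θ : Fin N → ℝ)
    (a b : Fin N) (ha : p a < 0) (hb : 0 < p b) (μ L U : ℝ)
    (hμ : μ =
      ((Finset.univ.filter (fun jk : Fin N × Fin N => p jk.1 < 0 ∧ 0 < p jk.2)).image
          (fun jk => ((-p jk.2) * θ jk.1 + p jk.1 * θ jk.2) / (p jk.1 - p jk.2)) ∪
        (Finset.univ.filter (fun j => p j = 0)).image θ).max'
        (Finset.Nonempty.inl (Finset.image_nonempty.mpr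
          ⟨(a, b), Finset.mem_filter.mpr ⟨Finset.mem_univ _, ha, hb⟩⟩)))
    (hL : L = (Finset.univ.filter (fun j => p j < 0)).sup'
      ⟨a, Finset.mem_filter.mpr ⟨Finset.mem_univ _, ha⟩⟩ (fun j => (μ - θ j) / p j))
    (hU : U = (Finset.univ.filter (fun j => 0 < p j)).inf'
      ⟨b, Finset.mem_filter.mpr ⟨Finset.mem_univ _, hb⟩⟩ (fun j => (μ - θ j) / p j)) :
    ∀ t : ℝ, fmax (fun j => θ j + p j * t) = μ → L ≤ t ∧ t ≤ U := by
  intro t ht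
  have h : ∀ j, θ j + p j * t ≤ μ := fun j =>
    ht ▸ Finset.le_sup' (fun j => θ j + p j * t) (Finset.mem_univ j)
  subst hL hU
  constructor
  · refine Finset.sup'_le _ _ fun j hj => ?_
    rw [div_le_iff_of_neg (Finset.mem_filter.mp hj).2]
    linarith [h j]
  · refine Finset.le_inf' _ _ fun j hj => ?_
    rw [le_div_iff₀ (Finset.mem_filter.mp hj).2]
    linarith [h j]
end

section
/- Parametric error representation for polynomial fitting: let x y : Fin M → ℝ and p : Fin N → ℝ, with M, N ≥ 1. Define the matrix X(p) i j = p j · x i, the error δ(p) = Δ(X(p), y) = max over i of ( y i − max over j of ( p j · x i + min over k of ( y k − p j · x k ) ) ), and the functions φ i (t) = y i − t · x i + max over k of ( t · x k − y k ). Then δ(p) = max over i of ( min over j of φ i (p j) ). -/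
open Finset

theorem fmin_const_sub {n : ℕ} [NeZero n] (c : ℝ) (f : Fin n → ℝ) :
    fmin (fun i => c - f i) = c - fmax f := by
  apply le_antisymm
  · obtain ⟨i, -, hi⟩ := Finset.exists_mem_eq_sup' Finset.univ_nonempty f
    rw [fmax, hi]
    exact Finset.inf'_le (fun i => c - f i) (Finset.mem_univ i)
  · exact Finset.le_inf' _ _ fun i hi => sub_le_sub_left (Finset.le_sup' f hi) c

theorem fmin_sub_eq_neg_fmax_sub {n : ℕ} [NeZero n] (f g : Fin n → ℝ) :
    fmin (fun i => f i - g i) = -fmax (fun i => g i - f i) := by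
  simpa using fmin_const_sub 0 fun i => g i - f i

/-- parametric error representation for polynomial fitting:
`δ(p) = max_i min_j φ i (p j)` where `φ i t = y i − t·x i + max_k (t·x k − y k)`. -/
theorem poly_fit_error_representation (M N : ℕ) [NeZero M] [NeZero N]
    (x y : Fin M → ℝ) (p : Fin N → ℝ) :
    fmax (fun i => y i - fmax (fun j => p j * x i + fmin (fun k => y k - p j * x k))) =
      fmax (fun i => fmin (fun j =>
        y i - p j * x i + fmax (fun k => p j * x k - y k))) := by
  congr 1
  funext i
  rw [← fmin_const_sub]
  congr 1
  funext j
  rw [fmin_sub_eq_neg_fmax_sub]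
  ring
end

section
/- Reduction of exponent optimization to a partition problem: let M, N ≥ 1 and F : Fin M → ℝ → ℝ with each F i bounded below. Then the infimum over p : Fin N → ℝ of max over i of (min over j of F i (p j)) equals the minimum over all functions g : Fin M → Fin N of the maximum, over those j in the range of g, of the infimum over t ∈ ℝ of the maximum of F i (t) over i with g i = j. -/
open Finset

/-- A finite maximum of functions bounded below is bounded below. -/
lemma bddBelow_range_sup' {ι α : Type*} {F : ι → α → ℝ} (hF : ∀ i, BddBelow (Set.range (F i)))
    (s : Finset ι) (hs : s.Nonempty) :
    BddBelow (Set.range fun t => s.sup' hs fun i => F i t) := by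
  obtain ⟨i, hi⟩ := hs
  obtain ⟨b, hb⟩ := hF i
  refine ⟨b, ?_⟩
  rintro _ ⟨t, rfl⟩
  exact (hb ⟨t, rfl⟩).trans (Finset.le_sup' (fun i => F i t) hi)

/-- A finite minimum of values of a function bounded below is bounded below. -/
lemma bddBelow_range_fmin {n : ℕ} [NeZero n] {α : Type*} {f : α → ℝ}
    (hf : BddBelow (Set.range f)) :
    BddBelow (Set.range fun p : Fin n → α => fmin fun j => f (p j)) := by
  obtain ⟨b, hb⟩ := hf
  refine ⟨b, ?_⟩
  rintro _ ⟨p, rfl⟩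
  exact Finset.le_inf' _ _ fun j _ => hb ⟨p j, rfl⟩

/-- reduction of exponent optimization to a partition problem:
`inf_p max_i min_j F i (p j)` equals the minimum over all `g : Fin M → Fin N` of the
maximum, over the indices `j` in the range of `g`, of `inf_t max_{i : g i = j} F i t`. -/
theorem inf_exponents_eq_min_over_partitions (M N : ℕ) [NeZero M] [NeZero N]
    (F : Fin M → ℝ → ℝ) (hF : ∀ i, BddBelow (Set.range (F i))) :
    (⨅ p : Fin N → ℝ, fmax (fun i => fmin (fun j => F i (p j)))) =
      (Finset.univ : Finset (Fin M → Fin N)).inf' Finset.univ_nonempty (fun g =>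
        (Finset.univ.filter (fun j => ∃ i, g i = j)).attach.sup'
          (Finset.attach_nonempty_iff.mpr
            ⟨g (Classical.arbitrary (Fin M)),
              Finset.mem_filter.mpr ⟨Finset.mem_univ _, ⟨_, rfl⟩⟩⟩)
          (fun j => ⨅ t : ℝ,
            (Finset.univ.filter (fun i => g i = j.1)).sup'
              (by
                obtain ⟨i, hi⟩ := (Finset.mem_filter.mp j.2).2
                exact ⟨i, Finset.mem_filter.mpr ⟨Finset.mem_univ _, hi⟩⟩)
              (fun i => F i t))) := by
  apply le_antisymm
  · refine Finset.le_inf' _ _ fun g _ => le_of_forall_pos_le_add fun ε hε => ?_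
    have near_inf : ∀ j, ∃ t : ℝ, ∀ h : (Finset.univ.filter fun i => g i = j).Nonempty,
        (Finset.univ.filter fun i => g i = j).sup' h (fun i => F i t) <
          (⨅ t : ℝ, (Finset.univ.filter fun i => g i = j).sup' h fun i => F i t) + ε := by
      intro j
      by_cases h : (Finset.univ.filter fun i => g i = j).Nonempty
      · obtain ⟨t, ht⟩ := exists_lt_of_ciInf_lt (lt_add_of_pos_right
          (⨅ t : ℝ, (Finset.univ.filter fun i => g i = j).sup' h fun i => F i t) hε)
        exact ⟨t, fun _ => ht⟩
      · exact ⟨0, fun h' => absurd h' h⟩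
    choose p hp using near_inf
    refine (ciInf_le (bddBelow_range_sup' (fun i => bddBelow_range_fmin (hF i)) _ _) p).trans ?_
    refine Finset.sup'_le _ _ fun i _ => ?_
    have hi : i ∈ Finset.univ.filter fun i' => g i' = g i := by simp
    refine (Finset.inf'_le _ (Finset.mem_univ (g i))).trans ?_
    refine (Finset.le_sup' (fun i' => F i' (p (g i))) hi).trans ((hp (g i) ⟨i, hi⟩).le.trans ?_)
    have hj : g i ∈ Finset.univ.filter fun j => ∃ i, g i = j := by simp
    refine add_le_add_left ?_ ε
    apply Finset.le_sup'_of_le _ (Finset.mem_attach _ ⟨g i, hj⟩)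
    exact le_rfl
  · refine le_ciInf fun p => ?_
    have argmin : ∀ i, ∃ j, fmin (fun j => F i (p j)) = F i (p j) := fun i => by
      obtain ⟨j, -, hj⟩ := Finset.exists_mem_eq_inf' Finset.univ_nonempty fun j => F i (p j)
      exact ⟨j, hj⟩
    choose g hg using argmin
    refine (Finset.inf'_le _ (Finset.mem_univ g)).trans (Finset.sup'_le _ _ fun j _ => ?_)
    refine (ciInf_le (bddBelow_range_sup' hF _ _) (p j)).trans (Finset.sup'_le _ _ fun i hi => ?_)
    rw [← (Finset.mem_filter.mp hi).2, ← hg i]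
    exact Finset.le_sup' (fun i => fmin fun j => F i (p j)) (Finset.mem_univ i)
end
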